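/- Let q be a prime power and let n, k, r, d be positive integers such that (r+1) divides n, r < k < rn/(r+1), d < n, and d · q^{−nr/(r+1) + k} · min_{0<s≤1} b(s)^{n/(r+1)} s^{−d} < 1, where b(s) = q^{−1}((1 + (q−1)s)^{r+1} + (q−1)(1−s)^{r+1}). Then there exists a q-ary linear code C ⊆ F_q^n of dimension at least k and minimum distance at least d such that every coordinate of C has a recovering set of size at most r. -/

import Mathlib

open Finset in
theorem lrc_W {F : Type*} [Field F] [Fintype F] [DecidableEq F] (s : ℝ) (t : ℕ) (c : F) :
    (Fintype.card F : ℝ) * ∑ x : Fin t → F, (if ∑ i, x i = c then s ^ hammingNorm x else 0)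
      = (1 + ((Fintype.card F : ℝ) - 1) * s) ^ t
        + (if c = 0 then (Fintype.card F : ℝ) - 1 else -1) * (1 - s) ^ t := by
  induction t generalizing c with
  | zero =>
    by_cases h : c = 0
    · simp [h, hammingNorm]
    · simp [h, Ne.symm h]
  | succ t ih =>
    have hnorm : ∀ (a : F) (x : Fin t → F),
        s ^ hammingNorm (Fin.cons a x : Fin (t + 1) → F)
          = (if a = 0 then 1 else s) * s ^ hammingNorm x := by
      intro a x
      have : hammingNorm (Fin.cons a x : Fin (t + 1) → F)
          = (if a = 0 then 0 else 1) + hammingNorm x := by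
        simp only [hammingNorm, Finset.card_filter, Fin.sum_univ_succ, Fin.cons_zero,
          Fin.cons_succ]
        by_cases h : a = 0 <;> simp [h]
      rw [this, pow_add]
      by_cases h : a = 0 <;> simp [h]
    have hsum : ∑ x : Fin (t + 1) → F, (if ∑ i, x i = c then s ^ hammingNorm x else 0)
        = ∑ a : F, (if a = 0 then 1 else s) *
          ∑ x : Fin t → F, (if ∑ i, x i = c - a then s ^ hammingNorm x else 0) := by
      rw [← (Fin.consEquiv (fun _ : Fin (t + 1) => F)).sum_comp, Fintype.sum_prod_type]
      refine Finset.sum_congr rfl fun a _ => ?_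
      rw [Finset.mul_sum]
      refine Finset.sum_congr rfl fun x _ => ?_
      have : (∑ i, (Fin.consEquiv (fun _ : Fin (t + 1) => F)) (a, x) i = c) ↔ ∑ i, x i = c - a := by
        simp only [Fin.consEquiv, Equiv.coe_fn_mk, Fin.sum_univ_succ, Fin.cons_zero, Fin.cons_succ]
        constructor
        · intro h; rw [← h]; ring
        · intro h; rw [h]; ring
      rw [if_congr this rfl rfl]
      split_ifs with h1 h2 <;> simp [Fin.consEquiv, hnorm, *]
    rw [hsum, Finset.mul_sum]
    have h1 : ∀ a : F, (Fintype.card F : ℝ) * ((if a = 0 then 1 else s) *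
          ∑ x : Fin t → F, (if ∑ i, x i = c - a then s ^ hammingNorm x else 0))
        = s * (1 + ((Fintype.card F : ℝ) - 1) * s) ^ t
          + s * (1 - s) ^ t * ((if a = c then (Fintype.card F : ℝ) else 0) - 1)
          + (if a = 0 then (1 - s) * ((1 + ((Fintype.card F : ℝ) - 1) * s) ^ t
        + (if c = 0 then (Fintype.card F : ℝ) - 1 else -1) * (1 - s) ^ t) else 0) := by
      intro a
      rw [mul_left_comm, ih]
      have hca : (c - a = 0) ↔ a = c := by rw [sub_eq_zero]; exact eq_comm
      rw [if_congr hca rfl rfl]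
      by_cases ha : a = 0
      · subst ha
        by_cases hc : c = 0
        · simp [hc]; ring
        · simp [hc, Ne.symm hc]; ring
      · by_cases hc : a = c
        · subst hc; simp only [ha, if_false, if_true]; ring
        · simp only [ha, hc, if_false]; ring
    rw [Finset.sum_congr rfl fun a _ => h1 a, Finset.sum_add_distrib, Finset.sum_add_distrib,
      ← Finset.mul_sum, ← Finset.mul_sum, Finset.sum_sub_distrib]
    simp
    split_ifs <;> ring

theorem lrc_greedy {F V : Type*} [Field F] [Fintype F] [AddCommGroup V] [Module F V] [Finite V]
    (C0 : Submodule F V) (bad : Set V) (k : ℕ)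
    (hsm : ∀ (a : F) (x : V), x ∈ bad → a • x ∈ bad) (h0 : (0 : V) ∈ bad)
    (hcard : Nat.card {x : V // x ∈ C0 ∧ x ∈ bad} * Fintype.card F ^ k < Nat.card C0) :
    ∃ C : Submodule F V, C ≤ C0 ∧ k ≤ Module.finrank F C ∧ ∀ x ∈ C, x ∈ bad → x = 0 := by
  classical
  have hfin : Finite (Submodule F V) := Finite.of_injective _ SetLike.coe_injective
  obtain ⟨C, ⟨hC0, hCb⟩, hmax⟩ := Set.exists_max_image
    {C : Submodule F V | C ≤ C0 ∧ ∀ x ∈ C, x ∈ bad → x = 0} (fun C => Module.finrank F C)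
    (Set.toFinite _) ⟨⊥, bot_le, by simp +contextual⟩
  refine ⟨C, hC0, ?_, hCb⟩
  by_contra hk
  push Not at hk
  have hsurj : Function.Surjective
      (fun p : {x : V // x ∈ C0 ∧ x ∈ bad} × C =>
        (⟨p.1.1 + p.2.1, C0.add_mem p.1.2.1 (hC0 p.2.2)⟩ : C0)) := by
    rintro ⟨v, hv⟩
    by_cases hvC : v ∈ C
    · exact ⟨(⟨0, C0.zero_mem, h0⟩, ⟨v, hvC⟩), by simp⟩
    have hlt : C < C ⊔ Submodule.span F {v} := by
      refine lt_of_le_of_ne le_sup_left fun h => hvC ?_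
      rw [h]; exact Submodule.mem_sup_right (Submodule.mem_span_singleton_self v)
    have hfl := Submodule.finrank_lt_finrank_of_lt hlt
    have hnot : ¬ ((C ⊔ Submodule.span F {v}) ≤ C0 ∧
        ∀ x ∈ (C ⊔ Submodule.span F {v}), x ∈ bad → x = 0) := by
      intro h
      have := hmax _ h
      exact absurd hfl (not_lt.mpr this)
    have hle : (C ⊔ Submodule.span F {v}) ≤ C0 :=
      sup_le hC0 ((Submodule.span_singleton_le_iff_mem _ _).2 hv)
    have : ∃ x ∈ (C ⊔ Submodule.span F {v}), x ∈ bad ∧ x ≠ 0 := by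
      by_contra hcon
      push Not at hcon
      exact hnot ⟨hle, hcon⟩
    obtain ⟨x, hx, hxb, hx0⟩ := this
    obtain ⟨c, hc, w, hw, hcw⟩ := Submodule.mem_sup.1 hx
    obtain ⟨a, rfl⟩ := Submodule.mem_span_singleton.1 hw
    have ha : a ≠ 0 := by
      rintro rfl
      refine hx0 (hCb x ?_ hxb)
      rw [← hcw]; simpa using hc
    refine ⟨(⟨a⁻¹ • x, C0.smul_mem _ (hle hx), hsm _ _ hxb⟩, ⟨-(a⁻¹ • c), C.neg_mem (C.smul_mem _ hc)⟩), ?_⟩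
    ext
    simp only
    rw [← hcw, smul_add, smul_smul, inv_mul_cancel₀ ha, one_smul]
    abel
  have h1 := Nat.card_le_card_of_surjective _ hsurj
  rw [Nat.card_prod, Module.natCard_eq_pow_finrank (K := F) (V := C), Nat.card_eq_fintype_card (α := F)] at h1
  have h2 : Fintype.card F ^ Module.finrank F C ≤ Fintype.card F ^ k :=
    Nat.pow_le_pow_right Fintype.card_pos hk.le
  have h3 := Nat.mul_le_mul_left (Nat.card {x : V // x ∈ C0 ∧ x ∈ bad}) h2
  omega

/-- block parity map -/
def lrcP (F : Type*) [Field F] {ι : Type*} (m t : ℕ) (e : Fin m × Fin t ≃ ι) :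
    (ι → F) →ₗ[F] (Fin m → F) where
  toFun x i := ∑ j, x (e (i, j))
  map_add' x y := by ext i; simp [Finset.sum_add_distrib]
  map_smul' a x := by ext i; simp [Finset.mul_sum]

theorem lrc_enum {F : Type*} [Field F] [Fintype F] [DecidableEq F] (s : ℝ) {n : ℕ} (m t : ℕ)
    (e : Fin m × Fin t ≃ Fin n) :
    ∑ x : Fin n → F, (if lrcP F m t e x = 0 then s ^ hammingNorm x else 0)
      = (∑ y : Fin t → F, (if ∑ j, y j = 0 then s ^ hammingNorm y else 0)) ^ m := by
  have hp : (∑ y : Fin t → F, (if ∑ j, y j = 0 then s ^ hammingNorm y else 0)) ^ m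
      = ∏ _i : Fin m, ∑ y : Fin t → F, (if ∑ j, y j = 0 then s ^ hammingNorm y else 0) := by simp
  rw [hp, Finset.prod_univ_sum, Fintype.piFinset_univ]
  let E : (Fin n → F) ≃ (Fin m → Fin t → F) :=
    (Equiv.arrowCongr e.symm (Equiv.refl F)).trans (Equiv.curry _ _ _)
  have hE : ∀ x i j, E x i j = x (e (i, j)) := fun x i j => rfl
  rw [← E.sum_comp]
  refine Finset.sum_congr rfl fun x _ => ?_
  have hn : hammingNorm x = ∑ i, hammingNorm (E x i) := by
    simp only [hammingNorm, Finset.card_filter, hE]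
    rw [← e.sum_comp, Fintype.sum_prod_type]
  by_cases h : lrcP F m t e x = 0
  · have h' : ∀ i, ∑ j, E x i j = 0 := fun i => congrFun h i
    simp only [h, h', if_true]
    rw [hn, Finset.prod_pow_eq_pow_sum]
  · rw [if_neg h]
    obtain ⟨i, hi⟩ := Function.ne_iff.1 h
    refine (Finset.prod_eq_zero (Finset.mem_univ i) ?_).symm
    exact if_neg hi

theorem lrc_bad {F : Type*} [Field F] [Fintype F] [DecidableEq F] (s : ℝ) (hs : 0 < s) (hs1 : s ≤ 1)
    {n : ℕ} (m t d : ℕ) (e : Fin m × Fin t ≃ Fin n) :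
    (Nat.card {x : Fin n → F // x ∈ LinearMap.ker (lrcP F m t e) ∧ x ∈ {x | hammingNorm x < d}} : ℝ)
      * s ^ d ≤ (∑ y : Fin t → F, (if ∑ j, y j = 0 then s ^ hammingNorm y else 0)) ^ m := by
  classical
  rw [← lrc_enum s m t e, Nat.card_eq_fintype_card, Fintype.card_subtype, Finset.card_filter]
  push_cast
  rw [Finset.sum_mul]
  refine Finset.sum_le_sum fun x _ => ?_
  simp only [LinearMap.mem_ker, Set.mem_setOf_eq]
  have := pow_pos hs (hammingNorm x)
  by_cases h : lrcP F m t e x = 0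
  · by_cases h2 : hammingNorm x < d
    · simp only [h, h2, and_self, if_true, one_mul]
      exact pow_le_pow_of_le_one hs.le hs1 h2.le
    · simp [h, h2, this.le]
  · simp [h]

/-- Finite-length Gilbert–Varshamov-type existence bound for `q`-ary
LRC codes with one recovering set of size at most `r` for every coordinate. -/
theorem gv_bound_lrc {F : Type*} [Field F] [Fintype F] [DecidableEq F] (q n k r d : ℕ)
    (hq : Fintype.card F = q)
    (hn : 0 < n) (hk : 0 < k) (hr : 0 < r) (hd : 0 < d)
    (hdiv : (r + 1) ∣ n) (hrk : r < k) (hkn : (k : ℝ) < (r : ℝ) * n / ((r : ℝ) + 1))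
    (hdn : d < n)
    (hmin : ∃ s : ℝ, s ∈ Set.Ioc (0 : ℝ) 1 ∧
      (d : ℝ) * (q : ℝ) ^ (-(n : ℝ) * r / ((r : ℝ) + 1) + (k : ℝ)) *
        ((1 / (q : ℝ)) * ((1 + ((q : ℝ) - 1) * s) ^ (r + 1) +
          ((q : ℝ) - 1) * (1 - s) ^ (r + 1))) ^ ((n : ℝ) / ((r : ℝ) + 1)) *
        s ^ (-(d : ℝ)) < 1) :
    ∃ C : Submodule F (Fin n → F),
      k ≤ Module.finrank F C ∧
      (∀ x ∈ C, ∀ y ∈ C, x ≠ y → d ≤ hammingDist x y) ∧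
      (∀ i : Fin n, ∃ R : Finset (Fin n), i ∉ R ∧ R.card ≤ r ∧
        ∀ x ∈ C, ∀ y ∈ C, (∀ j ∈ R, x j = y j) → x i = y i) := by
  obtain ⟨s, ⟨hs, hs1⟩, hlt⟩ := hmin
  obtain ⟨m, hm⟩ := hdiv
  have hm' : m * (r + 1) = n := by rw [hm]; ring
  let e : Fin m × Fin (r + 1) ≃ Fin n := finProdFinEquiv.trans (finCongr hm')
  have hqpos : (0 : ℝ) < q := by rw [← hq]; exact_mod_cast Fintype.card_pos
  have hbad := lrc_bad (F := F) s hs hs1 m (r + 1) d e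
  set B := Nat.card {x : Fin n → F // x ∈ LinearMap.ker (lrcP F m (r + 1) e) ∧
    x ∈ {x | hammingNorm x < d}} with hB
  have hW := lrc_W (F := F) s (r + 1) 0
  rw [hq, if_pos rfl] at hW
  set W := ∑ y : Fin (r + 1) → F, (if ∑ j, y j = 0 then s ^ hammingNorm y else 0) with hWdef
  have hr1 : (r : ℝ) + 1 ≠ 0 := by positivity
  have e1 : (n : ℝ) / ((r : ℝ) + 1) = (m : ℕ) := by
    rw [hm]; push_cast; field_simp
  have e2 : -(n : ℝ) * r / ((r : ℝ) + 1) + (k : ℝ) = (k : ℝ) - ((m * r : ℕ) : ℝ) := by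
    rw [hm]; push_cast; field_simp; ring
  rw [e1, e2, ← hW, Real.rpow_natCast, Real.rpow_sub hqpos, Real.rpow_natCast, Real.rpow_natCast,
    Real.rpow_neg hs.le, Real.rpow_natCast, one_div, inv_mul_cancel_left₀ hqpos.ne'] at hlt
  have hsd : 0 < s ^ d := pow_pos hs d
  have hW0 : (B : ℝ) ≤ W ^ m * (s ^ d)⁻¹ := by
    rw [← div_eq_mul_inv, le_div_iff₀ hsd]; exact hbad
  have hreal : (B : ℝ) * (q : ℝ) ^ k < (q : ℝ) ^ (m * r) := by
    have hd1 : (1 : ℝ) ≤ d := by exact_mod_cast hd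
    have hqk : (0 : ℝ) < (q : ℝ) ^ k := pow_pos hqpos _
    have hqm : (0 : ℝ) < (q : ℝ) ^ (m * r) := pow_pos hqpos _
    have h1 : (q : ℝ) ^ k / (q : ℝ) ^ (m * r) * B < 1 := by
      refine lt_of_le_of_lt ?_ hlt
      calc (q : ℝ) ^ k / (q : ℝ) ^ (m * r) * B
          ≤ (q : ℝ) ^ k / (q : ℝ) ^ (m * r) * (W ^ m * (s ^ d)⁻¹) := by gcongr
        _ ≤ d * ((q : ℝ) ^ k / (q : ℝ) ^ (m * r) * (W ^ m * (s ^ d)⁻¹)) := by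
          refine le_mul_of_one_le_left ?_ hd1
          exact mul_nonneg (by positivity) (le_trans (Nat.cast_nonneg B) hW0)
        _ = _ := by ring
    rw [div_mul_eq_mul_div, div_lt_one hqm] at h1
    linarith
  have hnat : B * q ^ k < q ^ (m * r) := by exact_mod_cast hreal
  have hker : q ^ (m * r) ≤ Nat.card (LinearMap.ker (lrcP F m (r + 1) e)) := by
    rw [Module.natCard_eq_pow_finrank (K := F), Nat.card_eq_fintype_card, hq]
    refine Nat.pow_le_pow_right (by exact_mod_cast hqpos) ?_
    have h1 := LinearMap.finrank_range_add_finrank_ker (lrcP F m (r + 1) e)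
    have h2 := Submodule.finrank_le (LinearMap.range (lrcP F m (r + 1) e))
    rw [Module.finrank_fin_fun] at h1 h2
    have : m * (r + 1) = m * r + m := by ring
    omega
  obtain ⟨C, hC0, hkC, hC⟩ := lrc_greedy (F := F) (LinearMap.ker (lrcP F m (r + 1) e))
    {x | hammingNorm x < d} k
    (fun a x hx => lt_of_le_of_lt (show hammingNorm (a • x) ≤ hammingNorm x by
      simp only [hammingNorm]
      refine Finset.card_le_card fun i => ?_
      simp) hx)
    (by simpa using hd) (by rw [hq]; exact lt_of_lt_of_le hnat hker)
  refine ⟨C, hkC, ?_, ?_⟩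
  · intro x hx y hy hxy
    by_contra hlt'
    push Not at hlt'
    rw [hammingDist_eq_hammingNorm] at hlt'
    have := hC (-x + y) (C.add_mem (C.neg_mem hx) hy) hlt'
    exact hxy (neg_add_eq_zero.1 this)
  · intro i
    obtain ⟨⟨a, b⟩, rfl⟩ := e.surjective i
    refine ⟨(Finset.univ.erase b).image fun j => e (a, j), ?_, ?_, ?_⟩
    · simp
    · refine Finset.card_image_le.trans ?_
      simp [Finset.card_erase_of_mem]
    · intro x hx y hy h
      have hx' : ∑ j, x (e (a, j)) = 0 := congrFun (LinearMap.mem_ker.1 (hC0 hx)) a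
      have hy' : ∑ j, y (e (a, j)) = 0 := congrFun (LinearMap.mem_ker.1 (hC0 hy)) a
      rw [← Finset.add_sum_erase _ _ (Finset.mem_univ b)] at hx' hy'
      have : ∑ j ∈ Finset.univ.erase b, x (e (a, j)) = ∑ j ∈ Finset.univ.erase b, y (e (a, j)) :=
        Finset.sum_congr rfl fun j hj => h _ (Finset.mem_image_of_mem _ hj)
      rw [this, ← hy'] at hx'
      exact add_right_cancel hx'
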